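/- Let E be the closed segment from z + ρ to z + ε on the real-direction radius of the disk B(z, ε), with 0 < ρ < ε. Then the harmonic measure of E seen from z in B(z, ε) \ E equals (2/π) arctan[(1/2)(√(ε/ρ) − √(ρ/ε))], and in particular it tends to 1 as ρ/ε → 0. -/

import Mathlib

open MeasureTheory Filter

/-- The complex upper half-plane. -/
def UH : Set ℂ := {z | 0 < z.im}

/-- A planar Brownian motion with sample space `Ω`: a family of probability
measures `P w` (the law of Brownian motion started at `w`), with continuous
paths, Gaussian increments and independent increments. -/
structure PlanarBM (Ω : Type*) [MeasurableSpace Ω] where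
  Z : ℝ → Ω → ℂ
  P : ℂ → Measure Ω
  isProb : ∀ w, IsProbabilityMeasure (P w)
  meas : ∀ t, Measurable (Z t)
  start : ∀ w, ∀ᵐ ω ∂P w, Z 0 ω = w
  contPaths : ∀ w, ∀ᵐ ω ∂P w, Continuous fun t => Z t ω
  incrLaw : ∀ (w : ℂ) (s t : ℝ), 0 ≤ s → s ≤ t →
    (P w).map (fun ω => Z t ω - Z s ω) =
      (((ProbabilityTheory.gaussianReal 0 (Real.toNNReal (t - s))).prod
        (ProbabilityTheory.gaussianReal 0 (Real.toNNReal (t - s)))).map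
        fun p : ℝ × ℝ => Complex.equivRealProd.symm p)
  indepIncr : ∀ (w : ℂ) (s t : ℝ), 0 ≤ s → s ≤ t →
    ProbabilityTheory.IndepFun (fun ω => Z t ω - Z s ω)
      (fun ω => fun u : Set.Iic s => Z u.1 ω) (P w)

/-- First hitting time of the set `A` by the path `f` (∞ if never hit). -/
noncomputable def hitTime (f : ℝ → ℂ) (A : Set ℂ) : ENNReal :=
  sInf (ENNReal.ofReal '' {t : ℝ | 0 ≤ t ∧ f t ∈ A})

/-- First exit time of the path `f` from the set `D`. -/
noncomputable def exitTime (f : ℝ → ℂ) (D : Set ℂ) : ENNReal :=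
  hitTime f Dᶜ

/-- The path `f` exits the domain `D` (in finite time) through the set `B`. -/
def exitsInto (f : ℝ → ℂ) (D B : Set ℂ) : Prop :=
  ∃ t : ℝ, 0 ≤ t ∧ ENNReal.ofReal t = exitTime f D ∧ f t ∈ B

/-- Harmonic measure of `B` in `D` seen from `z`: the probability that Brownian
motion started at `z` exits `D` through `B`. -/
noncomputable def Hm {Ω : Type*} [MeasurableSpace Ω] (BM : PlanarBM Ω)
    (D B : Set ℂ) (z : ℂ) : ENNReal :=
  BM.P z {ω | exitsInto (fun t => BM.Z t ω) D B}

/-- The radial slit `{z + t : ρ ≤ t ≤ ε}` in the disk `B(z, ε)`. -/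
def radialSlit (z : ℂ) (ρ ε : ℝ) : Set ℂ :=
  {w | ∃ t : ℝ, ρ ≤ t ∧ t ≤ ε ∧ w = z + (t : ℂ)}

/-- The law of an increment of planar Brownian motion over a time span `v`. -/
noncomputable def planarGaussian (v : NNReal) : Measure ℂ :=
  ((ProbabilityTheory.gaussianReal 0 v).prod (ProbabilityTheory.gaussianReal 0 v)).map
    fun p : ℝ × ℝ => Complex.equivRealProd.symm p

lemma measurable_equivRealProd_symm :
    Measurable fun p : ℝ × ℝ => Complex.equivRealProd.symm p :=
  Complex.measurableEquivRealProd.symm.measurable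

instance isProbabilityMeasure_planarGaussian (v : NNReal) :
    IsProbabilityMeasure (planarGaussian v) :=
  Measure.isProbabilityMeasure_map measurable_equivRealProd_symm.aemeasurable

lemma charFun_planarGaussian (v : NNReal) (t : ℂ) :
    charFun (planarGaussian v) t = Complex.exp (-(v * ‖t‖ ^ 2 / 2 : ℝ)) := by
  have hsplit : charFun (planarGaussian v) t =
      charFun (ProbabilityTheory.gaussianReal 0 v) t.re *
        charFun (ProbabilityTheory.gaussianReal 0 v) t.im := by
    unfold planarGaussian
    rw [charFun_apply, integral_map measurable_equivRealProd_symm.aemeasurable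
      (by fun_prop), charFun_apply, charFun_apply, ← integral_prod_mul]
    refine integral_congr_ae (.of_forall fun p => ?_)
    simp only [← Complex.exp_add, Complex.inner]
    congr 1
    simp
    ring
  rw [hsplit, ProbabilityTheory.charFun_gaussianReal, ProbabilityTheory.charFun_gaussianReal,
    ← Complex.exp_add, Complex.sq_norm, Complex.normSq_apply]
  congr 1
  push_cast
  ring

lemma planarGaussian_map_mul (v : NNReal) {c : ℂ} (hc : ‖c‖ = 1) :
    (planarGaussian v).map (fun x => c * x) = planarGaussian v := by
  have : IsProbabilityMeasure ((planarGaussian v).map (fun x => c * x)) :=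
    Measure.isProbabilityMeasure_map (by fun_prop)
  refine Measure.ext_of_charFun (funext fun t => ?_)
  have h : charFun ((planarGaussian v).map (fun x => c * x)) t =
      charFun (planarGaussian v) ((starRingEnd ℂ) c * t) := by
    rw [charFun_apply, integral_map (by fun_prop) (by fun_prop), charFun_apply]
    refine integral_congr_ae (.of_forall fun x => ?_)
    simp only [Complex.inner, map_mul]
    congr 4
    ring
  rw [h, charFun_planarGaussian, charFun_planarGaussian]
  simp [hc]

lemma gaussianReal_abs_ge_le (v : NNReal) {a : ℝ} (ha : 0 ≤ a) :
    (ProbabilityTheory.gaussianReal 0 v).real {x | a ≤ |x|} ≤ 2 * Real.exp (-a ^ 2 / (2 * v)) := by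
  have hX : ProbabilityTheory.HasSubgaussianMGF (id : ℝ → ℝ) v
      (ProbabilityTheory.gaussianReal 0 v) :=
    ⟨fun t => ProbabilityTheory.integrable_exp_mul_gaussianReal t, fun t => by
      rw [ProbabilityTheory.mgf_id_gaussianReal]; simp⟩
  have h1 := hX.measure_ge_le ha
  have h2 := hX.neg.measure_ge_le ha
  have hsub : {x : ℝ | a ≤ |x|} ⊆ {x | a ≤ id x} ∪ {x | a ≤ (-id) x} := by
    intro x hx
    simpa [le_abs] using hx
  calc _ ≤ _ := measureReal_mono hsub
    _ ≤ _ := measureReal_union_le _ _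
    _ ≤ _ := by linarith

lemma planarGaussian_norm_ge_le (v : NNReal) {a : ℝ} (ha : 0 ≤ a) :
    (planarGaussian v).real {x | a ≤ ‖x‖} ≤ 4 * Real.exp (-a ^ 2 / (8 * v)) := by
  have hsub : (fun p : ℝ × ℝ => Complex.equivRealProd.symm p) ⁻¹' {x | a ≤ ‖x‖} ⊆
      (Prod.fst ⁻¹' {x : ℝ | a / 2 ≤ |x|}) ∪ (Prod.snd ⁻¹' {x : ℝ | a / 2 ≤ |x|}) := by
    intro p hp
    have h : ‖Complex.equivRealProd.symm p‖ ≤ |p.1| + |p.2| := by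
      simpa using Complex.norm_le_abs_re_add_abs_im (Complex.equivRealProd.symm p)
    have hp' : a ≤ ‖Complex.equivRealProd.symm p‖ := hp
    by_contra hcon
    have h1 : ¬ a / 2 ≤ |p.1| := fun h' => hcon (Or.inl h')
    have h2 : ¬ a / 2 ≤ |p.2| := fun h' => hcon (Or.inr h')
    linarith
  have hm : MeasurableSet {x : ℝ | a / 2 ≤ |x|} :=
    measurableSet_le measurable_const (by fun_prop)
  have h1 := gaussianReal_abs_ge_le v (show 0 ≤ a / 2 by positivity)
  rw [planarGaussian, map_measureReal_apply measurable_equivRealProd_symm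
    (measurableSet_le measurable_const (by fun_prop))]
  calc _ ≤ _ := measureReal_mono hsub
    _ ≤ _ := measureReal_union_le _ _
    _ = _ := congrArg₂ _ (measurePreserving_fst.measureReal_preimage hm.nullMeasurableSet)
        (measurePreserving_snd.measureReal_preimage hm.nullMeasurableSet)
    _ ≤ _ := by
      have : -(a / 2) ^ 2 / (2 * (v : ℝ)) = -a ^ 2 / (8 * v) := by
        field_simp; norm_num
      rw [this] at h1
      linarith

/-- A bounded function with the circle mean value property near `w` is almost preserved by
averaging over a Gaussian increment. -/
lemma abs_integral_planarGaussian_sub_le (v : NNReal) {u : ℂ → ℝ} (hu : Measurable u)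
    (hb : ∀ x, |u x| ≤ 1) {w : ℂ} {a : ℝ}
    (hmean : ∀ s, 0 ≤ s → s < a → Real.circleAverage u w s = u w) :
    |∫ x, (u (w + x) - u w) ∂planarGaussian v| ≤ 2 * (planarGaussian v).real {x | a ≤ ‖x‖} := by
  set γ := planarGaussian v with hγ
  set g : ℂ → ℝ := fun x => u (w + x) - u w with hg
  have hgm : Measurable g := by fun_prop
  have hgb : ∀ x, |g x| ≤ 2 := fun x => by
    have h1 := abs_le.1 (hb (w + x)); have h2 := abs_le.1 (hb w)
    rw [abs_le]; constructor <;> simp only [hg] <;> linarith [h1.1, h1.2, h2.1, h2.2]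
  have hA : MeasurableSet {x : ℂ | a ≤ ‖x‖} := measurableSet_le measurable_const (by fun_prop)
  set k : ℂ → ℝ := ({x : ℂ | a ≤ ‖x‖}ᶜ).indicator g with hk
  have hkm : Measurable k := hgm.indicator hA.compl
  have hkb : ∀ x, ‖k x‖ ≤ 2 := fun x => by
    rw [hk, Set.indicator_apply]; split_ifs
    · exact hgb x
    · simp
  have hgi : Integrable g γ := .of_bound hgm.aestronglyMeasurable 2 (.of_forall hgb)
  have hk0 : ∫ x, k x ∂γ = 0 := by
    have hrot : ∀ θ : ℝ, ∫ x, k (Complex.exp (θ * Complex.I) * x) ∂γ = ∫ x, k x ∂γ := fun θ => by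
      conv_rhs => rw [hγ, ← planarGaussian_map_mul v (Complex.norm_exp_ofReal_mul_I θ)]
      rw [integral_map (by fun_prop) hkm.aestronglyMeasurable]
    have hI : Integrable (Function.uncurry fun (θ : ℝ) (x : ℂ) =>
        k (Complex.exp (θ * Complex.I) * x)) ((volume.restrict (Set.Ioc 0 (2 * Real.pi))).prod γ) :=
      .of_bound (by
        refine Measurable.aestronglyMeasurable (hkm.comp ?_)
        fun_prop) 2 (.of_forall fun _ => hkb _)
    have hzero : ∀ x, ∫ θ in Set.Ioc 0 (2 * Real.pi), k (Complex.exp (θ * Complex.I) * x) = 0 := by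
      intro x
      by_cases hx : a ≤ ‖x‖
      · simp [hk, hx]
      · have hm := hmean ‖x‖ (norm_nonneg x) (not_le.1 hx)
        have e1 : ∀ θ : ℝ, k (Complex.exp (θ * Complex.I) * x) =
            u (circleMap w ‖x‖ (θ + x.arg)) - u w := fun θ => by
          have : circleMap w ‖x‖ (θ + x.arg) = w + Complex.exp (θ * Complex.I) * x := by
            conv_rhs => rw [← Complex.norm_mul_exp_arg_mul_I x]
            rw [circleMap]
            push_cast
            rw [add_mul, Complex.exp_add]
            ring
          rw [this]
          simp [hk, hx, hg]
        have hi : IntervalIntegrable (fun θ : ℝ => u (circleMap w ‖x‖ (θ + x.arg))) volume 0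
            (2 * Real.pi) := by
          rw [intervalIntegrable_iff_integrableOn_Ioc_of_le (by positivity)]
          exact Integrable.of_bound (by
            refine Measurable.aestronglyMeasurable (hu.comp ?_)
            fun_prop) 1 (.of_forall fun _ => hb _)
        rw [← intervalIntegral.integral_of_le (by positivity)]
        simp_rw [e1]
        rw [intervalIntegral.integral_sub hi (by simp)]
        rw [Real.circleAverage_eq_integral_add x.arg, smul_eq_mul] at hm
        simp only [intervalIntegral.integral_const, smul_eq_mul, sub_zero]
        rw [← hm]
        field_simp
        ring
    have hswap := integral_integral_swap hI
    simp only [hrot, hzero, integral_zero] at hswap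
    simpa [Real.pi_pos.le, Real.pi_ne_zero] using hswap
  have hsplit : ∫ x, g x ∂γ = ∫ x in {x : ℂ | a ≤ ‖x‖}, g x ∂γ := by
    rw [← integral_add_compl hA hgi, ← integral_indicator hA.compl, hk0, add_zero]
  rw [hsplit]
  have := norm_setIntegral_le_of_norm_le_const (μ := γ) (s := {x : ℂ | a ≤ ‖x‖}) (f := g) (C := 2)
    (measure_lt_top _ _) (fun x _ => hgb x)
  simpa using this

/-- The path `f` stays in `G` up to time `t`, expressed through countably many times. -/
def staysIn (f : ℝ → ℂ) (G : Set ℂ) (t : ℝ) : Prop :=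
  ∀ q : ℚ≥0, f (min (q : ℝ) t) ∈ G

lemma staysIn_iff {f : ℝ → ℂ} (hf : Continuous f) {G : Set ℂ} (hG : IsClosed G) {t : ℝ}
    (ht : 0 ≤ t) : staysIn f G t ↔ ∀ s, 0 ≤ s → s ≤ t → f s ∈ G := by
  refine ⟨fun h s hs hst => ?_, fun h q => h _ (le_min (by positivity) ht) (min_le_right _ _)⟩
  by_contra hcon
  have hopen : IsOpen ((fun r => f (min r t)) ⁻¹' Gᶜ) :=
    hG.isOpen_compl.preimage (hf.comp (by fun_prop))
  obtain ⟨δ, hδ, hball⟩ := Metric.isOpen_iff.1 hopen s (by simpa [hst] using hcon)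
  obtain ⟨q, hq1, hq2⟩ := exists_rat_btwn (lt_add_of_pos_right s hδ)
  have hq0 : 0 ≤ q := by exact_mod_cast hs.trans hq1.le
  lift q to ℚ≥0 using hq0
  refine hball ?_ (h q)
  rw [Metric.mem_ball, Real.dist_eq, abs_lt]
  push_cast at hq1 hq2
  constructor <;> linarith

/-- The value of `u` along the path `f` sampled with mesh `h`, stopped at the first sampling time
by which `f` has left `G`, or after `k` steps. -/
noncomputable def stoppedSum (u : ℂ → ℝ) (f : ℝ → ℂ) (G : Set ℂ) (h : ℝ) (k : ℕ) : ℝ :=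
  u (f 0) + ∑ j ∈ Finset.range k, Set.indicator {g : ℝ → ℂ | staysIn g G (j * h)}
    (fun g => u (g ((j + 1) * h)) - u (g (j * h))) f

lemma exists_stoppedSum_eq {u : ℂ → ℝ} {f : ℝ → ℂ} (hf : Continuous f) {G : Set ℂ}
    (hG : IsClosed G) {h : ℝ} (hh : 0 ≤ h) (k : ℕ) :
    ∃ N ≤ k, stoppedSum u f G h k = u (f (N * h)) ∧ (N < k → ¬ staysIn f G (N * h)) ∧
      ∀ j < N, staysIn f G (j * h) := by
  induction k with
  | zero => exact ⟨0, le_rfl, by simp [stoppedSum], by simp, by simp⟩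
  | succ k ih =>
    obtain ⟨N, hNk, hN, hout, hin⟩ := ih
    have hsum : stoppedSum u f G h (k + 1) = stoppedSum u f G h k +
        Set.indicator {g : ℝ → ℂ | staysIn g G (k * h)}
          (fun g => u (g ((k + 1) * h)) - u (g (k * h))) f := by
      rw [stoppedSum, stoppedSum, Finset.sum_range_succ, add_assoc]
    by_cases hk : staysIn f G (k * h)
    · have hNk' : N = k := by
        by_contra hne
        have hlt : N < k := lt_of_le_of_ne hNk hne
        refine hout hlt ?_
        rw [staysIn_iff hf hG (by positivity)] at hk ⊢
        exact fun s hs hs' => hk s hs (hs'.trans (by gcongr))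
      subst hNk'
      refine ⟨N + 1, le_rfl, ?_, by simp, fun j hj => ?_⟩
      · rw [hsum, hN, Set.indicator_of_mem (by exact hk)]
        push_cast
        ring
      · rcases Nat.lt_succ_iff_lt_or_eq.1 hj with hj | rfl
        exacts [hin j hj, hk]
    · refine ⟨N, hNk.trans k.le_succ, ?_, fun _ => ?_, hin⟩
      · rw [hsum, hN, Set.indicator_of_notMem (by exact hk), add_zero]
      · rcases hNk.lt_or_eq with hlt | rfl
        exacts [hout hlt, hk]

lemma measurable_stoppedSum {Ω : Type*} [MeasurableSpace Ω] (BM : PlanarBM Ω) {u : ℂ → ℝ}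
    (hu : Measurable u) {G : Set ℂ} (hG : MeasurableSet G) (h : ℝ) (k : ℕ) :
    Measurable fun ω => stoppedSum u (fun t => BM.Z t ω) G h k := by
  refine (hu.comp (BM.meas 0)).add (Finset.measurable_sum _ fun j _ => ?_)
  refine Measurable.indicator (s := {ω | staysIn (fun t => BM.Z t ω) G (j * h)})
    ((hu.comp (BM.meas _)).sub (hu.comp (BM.meas _))) ?_
  simp only [staysIn, Set.ofPred_forall]
  exact MeasurableSet.iInter fun q => BM.meas _ hG

lemma abs_integral_step_le {Ω : Type*} [MeasurableSpace Ω] (BM : PlanarBM Ω) (z : ℂ) {u : ℂ → ℝ}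
    (hu : Measurable u) (hb : ∀ x, |u x| ≤ 1) {G : Set ℂ} (hG : MeasurableSet G) {s t : ℝ}
    (hs : 0 ≤ s) (hst : s ≤ t) {δ : ℝ} (hδ0 : 0 ≤ δ)
    (hδ : ∀ w ∈ G, |∫ x, (u (w + x) - u w) ∂planarGaussian (Real.toNNReal (t - s))| ≤ δ) :
    |∫ ω, Set.indicator {g : ℝ → ℂ | staysIn g G s}
      (fun g => u (g t) - u (g s)) (fun r => BM.Z r ω) ∂BM.P z| ≤ δ := by
  have := BM.isProb z
  set past : Ω → Set.Iic s → ℂ := fun ω r => BM.Z r.1 ω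
  have hpast : Measurable past := measurable_pi_lambda _ fun r => BM.meas r.1
  have hincr : Measurable fun ω => BM.Z t ω - BM.Z s ω := (BM.meas t).sub (BM.meas s)
  have hprob : IsProbabilityMeasure ((BM.P z).map past) :=
    Measure.isProbabilityMeasure_map hpast.aemeasurable
  let A : Set (Set.Iic s → ℂ) :=
    {p | ∀ q : ℚ≥0, p ⟨min (q : ℝ) s, Set.mem_Iic.2 (min_le_right _ _)⟩ ∈ G}
  have hA : MeasurableSet A := by
    simp only [A, Set.ofPred_forall]
    exact MeasurableSet.iInter fun q => measurable_pi_apply _ hG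
  let e : Set.Iic s := ⟨s, Set.mem_Iic.2 le_rfl⟩
  have hAe : ∀ p ∈ A, p e ∈ G := fun p hp => by
    obtain ⟨n, hn⟩ := exists_nat_ge s
    have := hp n
    simpa [hn] using this
  let F : (Set.Iic s → ℂ) × ℂ → ℝ := fun x => A.indicator (fun p => u (p e + x.2) - u (p e)) x.1
  have hF : Measurable F := by
    have : F = ((Prod.fst : (Set.Iic s → ℂ) × ℂ → _) ⁻¹' A).indicator
        (fun x => u (x.1 e + x.2) - u (x.1 e)) := by
      ext x
      by_cases hx : x.1 ∈ A
      · rw [Set.indicator_of_mem (by exact hx)]; simp [F, hx]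
      · rw [Set.indicator_of_notMem (by exact hx)]; simp [F, hx]
    rw [this]
    refine Measurable.indicator ?_ (measurable_fst hA)
    fun_prop
  have hFb : ∀ x, ‖F x‖ ≤ 2 := fun x => by
    by_cases hx : x.1 ∈ A
    · simp only [F, Set.indicator_of_mem hx]
      have h1 := abs_le.1 (hb (x.1 e + x.2)); have h2 := abs_le.1 (hb (x.1 e))
      rw [Real.norm_eq_abs, abs_le]; constructor <;> linarith [h1.1, h1.2, h2.1, h2.2]
    · simp [F, hx]
  have hjoint : (BM.P z).map (fun ω => (past ω, BM.Z t ω - BM.Z s ω)) =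
      ((BM.P z).map past).prod (planarGaussian (Real.toNNReal (t - s))) := by
    have h := (ProbabilityTheory.indepFun_iff_map_prod_eq_prod_map_map hpast.aemeasurable
      hincr.aemeasurable).1 (BM.indepIncr z s t hs hst).symm
    rw [h, BM.incrLaw z s t hs hst, planarGaussian]
  have hcomp : ∀ ω, Set.indicator {g : ℝ → ℂ | staysIn g G s} (fun g => u (g t) - u (g s))
      (fun r => BM.Z r ω) = F (past ω, BM.Z t ω - BM.Z s ω) := fun ω => by
    have : staysIn (fun r => BM.Z r ω) G s ↔ past ω ∈ A := Iff.rfl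
    by_cases hω : past ω ∈ A
    · rw [Set.indicator_of_mem (this.2 hω)]
      simp [F, hω, past, e]
    · rw [Set.indicator_of_notMem (fun h' => hω (this.1 h'))]
      simp [F, hω]
  simp_rw [hcomp]
  rw [← integral_map (φ := fun ω => (past ω, BM.Z t ω - BM.Z s ω)) (f := F)
    (hpast.prodMk hincr).aemeasurable hF.aestronglyMeasurable, hjoint, integral_prod _
    (.of_bound hF.aestronglyMeasurable 2 (.of_forall hFb))]
  have hbound : ∀ p, ‖∫ x, F (p, x) ∂planarGaussian (Real.toNNReal (t - s))‖ ≤ δ := fun p => by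
    by_cases hp : p ∈ A
    · simpa [F, hp] using hδ _ (hAe p hp)
    · simpa [F, hp] using hδ0
  simpa using norm_integral_le_of_norm_le_const (.of_forall hbound) (μ := (BM.P z).map past)

lemma abs_integral_stoppedSum_sub_le {Ω : Type*} [MeasurableSpace Ω] (BM : PlanarBM Ω) (z : ℂ)
    {u : ℂ → ℝ} (hu : Measurable u) (hb : ∀ x, |u x| ≤ 1) {G : Set ℂ} (hG : MeasurableSet G)
    {h : ℝ} (hh : 0 ≤ h) {δ : ℝ} (hδ0 : 0 ≤ δ)
    (hδ : ∀ w ∈ G, |∫ x, (u (w + x) - u w) ∂planarGaussian (Real.toNNReal h)| ≤ δ) (k : ℕ) :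
    |∫ ω, stoppedSum u (fun t => BM.Z t ω) G h k ∂BM.P z - u z| ≤ k * δ := by
  have := BM.isProb z
  have hintM : ∀ j : ℕ, Integrable (fun ω => Set.indicator {g : ℝ → ℂ | staysIn g G (j * h)}
      (fun g => u (g ((j + 1) * h)) - u (g (j * h))) (fun r => BM.Z r ω)) (BM.P z) := fun j => by
    refine .of_bound (C := 2) (Measurable.aestronglyMeasurable ?_) (.of_forall fun ω => ?_)
    · have := (measurable_stoppedSum BM hu hG h (j + 1)).sub (measurable_stoppedSum BM hu hG h j)
      simpa [stoppedSum, Finset.sum_range_succ, Pi.sub_def] using this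
    · by_cases hω : staysIn (fun r => BM.Z r ω) G (j * h)
      · rw [Set.indicator_of_mem (by exact hω)]
        have h1 := abs_le.1 (hb (BM.Z ((j + 1) * h) ω)); have h2 := abs_le.1 (hb (BM.Z (j * h) ω))
        rw [Real.norm_eq_abs, abs_le]; constructor <;> linarith [h1.1, h1.2, h2.1, h2.2]
      · rw [Set.indicator_of_notMem (by exact hω)]
        simp
  have h0 : ∫ ω, u (BM.Z 0 ω) ∂BM.P z = u z := by
    rw [integral_congr_ae (g := fun _ => u z) ((BM.start z).mono fun ω hω => by simp [hω])]
    simp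
  have h0i : Integrable (fun ω => u (BM.Z 0 ω)) (BM.P z) :=
    .of_bound (C := 1) (hu.comp (BM.meas 0)).aestronglyMeasurable (.of_forall fun _ => hb _)
  simp only [stoppedSum]
  rw [integral_add h0i (integrable_finsetSum _ fun j _ => hintM j), h0, add_sub_cancel_left,
    integral_finsetSum _ fun j _ => hintM j]
  refine (Finset.abs_sum_le_sum_abs _ _).trans ?_
  calc _ ≤ ∑ j ∈ Finset.range k, δ := Finset.sum_le_sum fun j _ =>
        abs_integral_step_le BM z hu hb hG (by positivity) (by nlinarith) hδ0
          (by simpa [add_mul] using hδ)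
    _ = _ := by simp

/-- The points of `D` at distance at least `a` from its complement. -/
def innerCore (D : Set ℂ) (a : ℝ) : Set ℂ := {w | Metric.ball w a ⊆ D}

lemma isClosed_innerCore (D : Set ℂ) (a : ℝ) : IsClosed (innerCore D a) := by
  have : innerCore D a = ⋂ y ∈ Dᶜ, {w | a ≤ dist w y} := by
    ext w
    simp only [innerCore, Set.mem_ofPred_eq, Set.mem_iInter, Set.mem_compl_iff]
    refine ⟨fun h y hy => ?_, fun h y hy => ?_⟩
    · by_contra hlt
      exact hy (h (by rw [Metric.mem_ball, dist_comm]; exact not_le.1 hlt))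
    · by_contra hyD
      rw [Metric.mem_ball, dist_comm] at hy
      exact absurd (h y hyD) (not_le.2 hy)
  rw [this]
  exact isClosed_biInter fun y _ => isClosed_le continuous_const (by fun_prop)

/-- Stopping on finer and finer meshes when leaving larger and larger cores of `D` approximates
the exit time `τ` from `D`. -/
lemma tendsto_stopped_sampling {f : ℝ → ℂ} (hf : Continuous f) {D : Set ℂ} (hD : IsOpen D) {τ : ℝ}
    (hτ0 : 0 ≤ τ) (hτ : f τ ∉ D) (hin : ∀ t, 0 ≤ t → t < τ → f t ∈ D) {a h : ℕ → ℝ} {k N : ℕ → ℕ}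
    (ha0 : ∀ n, 0 < a n) (ha : Tendsto a atTop (nhds 0)) (hh0 : ∀ n, 0 ≤ h n)
    (hh : Tendsto h atTop (nhds 0))
    (hk : Tendsto (fun n => k n * h n) atTop atTop) (hNk : ∀ n, N n ≤ k n)
    (hout : ∀ n, N n < k n → ¬ staysIn f (innerCore D (a n)) (N n * h n))
    (hstay : ∀ n, ∀ j < N n, staysIn f (innerCore D (a n)) (j * h n)) :
    Tendsto (fun n => N n * h n) atTop (nhds τ) := by
  have hupper : ∀ n, N n * h n ≤ τ + h n := fun n => by
    rcases Nat.eq_zero_or_pos (N n) with h0 | hpos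
    · rw [h0]; simpa using add_nonneg hτ0 (hh0 n)
    · have hst := hstay n (N n - 1) (by omega)
      rw [staysIn_iff hf (isClosed_innerCore D _) (mul_nonneg (by positivity) (hh0 n)),
        Nat.cast_sub hpos] at hst
      by_contra! hlt
      refine hτ (hst τ hτ0 ?_ (Metric.mem_ball_self (ha0 n)))
      push_cast
      linarith
  have hlower : ∀ t < τ, ∀ᶠ n in atTop, t < N n * h n := by
    intro t ht
    rcases lt_or_ge t 0 with ht0 | ht0
    · exact .of_forall fun n => ht0.trans_le (mul_nonneg (by positivity) (hh0 n))
    have hK : IsCompact (f '' Set.Icc 0 t) := isCompact_Icc.image hf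
    have hKD : f '' Set.Icc 0 t ⊆ D := by
      rintro _ ⟨s, hs, rfl⟩
      exact hin s hs.1 (hs.2.trans_lt ht)
    obtain ⟨δ, hδ, hδD⟩ := hK.exists_thickening_subset_open hD hKD
    filter_upwards [ha.eventually (gt_mem_nhds hδ), hk.eventually_gt_atTop t] with n han hkn
    rcases (hNk n).lt_or_eq with hlt | heq
    · by_contra! hle
      refine hout n hlt ?_
      rw [staysIn_iff hf (isClosed_innerCore D _) (mul_nonneg (by positivity) (hh0 n))]
      intro s hs0 hs y hy
      refine hδD (Metric.mem_thickening_iff.2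
        ⟨f s, ⟨s, ⟨hs0, hs.trans hle⟩, rfl⟩, (Metric.mem_ball.1 hy).trans han⟩)
    · rwa [heq]
  refine tendsto_order.2 ⟨hlower, fun t ht => ?_⟩
  filter_upwards [hh.eventually (gt_mem_nhds (sub_pos.2 ht))] with n hn
  linarith [hupper n]

/-- A bounded function with the mean value property in `D` is, in expectation, preserved by
suitable samplings of Brownian motion that converge to the exit position. -/
lemma exists_sampling {Ω : Type*} [MeasurableSpace Ω] (BM : PlanarBM Ω) (z : ℂ) {u : ℂ → ℝ}
    (hu : Measurable u) (hb : ∀ x, |u x| ≤ 1) {D : Set ℂ} (hD : IsOpen D)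
    (hmean : ∀ w s, 0 ≤ s → Metric.closedBall w s ⊆ D → Real.circleAverage u w s = u w) :
    ∃ M : ℕ → Ω → ℝ, (∀ n, Measurable (M n)) ∧
      Tendsto (fun n => ∫ ω, M n ω ∂BM.P z) atTop (nhds (u z)) ∧
      ∀ᵐ ω ∂BM.P z, ∃ s : ℕ → ℝ, (∀ n, 0 ≤ s n ∧ M n ω = u (BM.Z (s n) ω)) ∧
        ∀ τ, 0 ≤ τ → BM.Z τ ω ∉ D → (∀ t, 0 ≤ t → t < τ → BM.Z t ω ∈ D) →
          Tendsto s atTop (nhds τ) := by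
  let a : ℕ → ℝ := fun n => 1 / ((n : ℝ) + 1)
  let h : ℕ → ℝ := fun n => 1 / ((n : ℝ) + 1) ^ 6
  let k : ℕ → ℕ := fun n => (n + 1) ^ 7
  have ha0 : ∀ n, 0 < a n := fun n => by positivity
  have hh0 : ∀ n, 0 < h n := fun n => by positivity
  have ha : Tendsto a atTop (nhds 0) := tendsto_one_div_add_atTop_nhds_zero_nat
  have hh : Tendsto h atTop (nhds 0) := by
    simpa [a, h] using ha.pow 6
  have hcast : Tendsto (fun n : ℕ => (n : ℝ) + 1) atTop atTop :=
    tendsto_atTop_add_const_right _ _ tendsto_natCast_atTop_atTop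
  have hk : Tendsto (fun n => k n * h n) atTop atTop := by
    refine hcast.congr fun n => ?_
    simp only [k, h]
    push_cast
    field_simp
  let δ : ℕ → ℝ := fun n => 2 * (4 * Real.exp (-a n ^ 2 / (8 * Real.toNNReal (h n))))
  have hδ : ∀ n, ∀ w ∈ innerCore D (a n),
      |∫ x, (u (w + x) - u w) ∂planarGaussian (Real.toNNReal (h n))| ≤ δ n := fun n w hw =>
    (abs_integral_planarGaussian_sub_le _ hu hb fun s hs hsa =>
      hmean w s hs ((Metric.closedBall_subset_ball hsa).trans hw)).trans
      (mul_le_mul_of_nonneg_left (planarGaussian_norm_ge_le _ (ha0 n).le) zero_le_two)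
  have hclosed := fun n => isClosed_innerCore D (a n)
  refine ⟨fun n ω => stoppedSum u (fun t => BM.Z t ω) (innerCore D (a n)) (h n) (k n),
    fun n => measurable_stoppedSum BM hu (hclosed n).measurableSet _ _, ?_, ?_⟩
  · have hdecay : Tendsto (fun n => k n * δ n) atTop (nhds 0) := by
      have hlim := ((Real.tendsto_pow_mul_exp_neg_atTop_nhds_zero 7).comp
        (hcast.atTop_div_const (show (0 : ℝ) < 8 by norm_num))).const_mul (8 * 8 ^ 7)
      rw [mul_zero] at hlim
      refine squeeze_zero (fun n => by positivity) (fun n => ?_) hlim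
      have hx : (1 : ℝ) ≤ (n : ℝ) + 1 := by linarith [n.cast_nonneg (α := ℝ)]
      have he : -a n ^ 2 / (8 * (Real.toNNReal (h n) : ℝ)) ≤ -(((n : ℝ) + 1) / 8) := by
        rw [Real.coe_toNNReal _ (hh0 n).le]
        have : -a n ^ 2 / (8 * h n) = -(((n : ℝ) + 1) ^ 4 / 8) := by
          simp only [a, h]
          field_simp
        rw [this]
        have := le_self_pow₀ hx (show 4 ≠ 0 by norm_num)
        linarith
      have hexp := Real.exp_le_exp.2 he
      simp only [k, δ, Function.comp]
      push_cast
      calc _ ≤ ((n : ℝ) + 1) ^ 7 * (2 * (4 * Real.exp (-(((n : ℝ) + 1) / 8)))) := by gcongr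
        _ = _ := by ring
    rw [tendsto_iff_norm_sub_tendsto_zero]
    exact squeeze_zero (fun _ => norm_nonneg _) (fun n =>
      abs_integral_stoppedSum_sub_le BM z hu hb (hclosed n).measurableSet (hh0 n).le
        (by positivity) (hδ n) (k n)) hdecay
  · filter_upwards [BM.contPaths z] with ω hω
    choose N hNk hN hout hstay using fun n =>
      exists_stoppedSum_eq (u := u) hω (hclosed n) (hh0 n).le (k n)
    refine ⟨fun n => N n * h n, fun n => ⟨mul_nonneg (by positivity) (hh0 n).le, hN n⟩, ?_⟩
    intro τ hτ0 hτ hin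
    exact tendsto_stopped_sampling hω hD hτ0 hτ hin ha0 ha (fun n => (hh0 n).le) hh hk hNk hout
      hstay

/-- The complex number whose argument is twice the angle subtended by the segment from `-1` to `1`
on the imaginary axis, seen from a square root of `a / b`. -/
noncomputable def subtended (a b : ℂ) : ℂ :=
  ((‖a‖ - ‖b‖ : ℝ) : ℂ) +
    (Real.sqrt (2 * (‖a‖ * ‖b‖ + (a * (starRingEnd ℂ) b).re)) : ℝ) * Complex.I

lemma subtended_re (a b : ℂ) : (subtended a b).re = ‖a‖ - ‖b‖ := by simp [subtended]

lemma subtended_im (a b : ℂ) : (subtended a b).im =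
    Real.sqrt (2 * (‖a‖ * ‖b‖ + (a * (starRingEnd ℂ) b).re)) := by simp [subtended]

lemma continuous_subtended {a b : ℂ → ℂ} (ha : Continuous a) (hb : Continuous b) :
    Continuous fun w => subtended (a w) (b w) := by
  unfold subtended
  fun_prop

lemma subtended_eq {a b : ℂ} (hb : b ≠ 0) {s : ℂ} (hs : 0 < s.re) (hsq : s * s = a / b) :
    subtended a b = ((‖b‖ * ‖s - Complex.I‖ ^ 2 : ℝ) : ℂ) *
      ((s + Complex.I) / (s - Complex.I)) := by
  have hne : s - Complex.I ≠ 0 := fun h => by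
    have := congrArg Complex.re h
    simp at this
    exact hs.ne' this
  have ha : a = s * s * b := by rw [hsq, div_mul_cancel₀ _ hb]
  have hna : ‖a‖ = ‖s‖ ^ 2 * ‖b‖ := by rw [ha]; simp [sq]
  have hns : ‖s‖ ^ 2 = s.re * s.re + s.im * s.im := by rw [Complex.sq_norm, Complex.normSq_apply]
  have hroot : 2 * (‖a‖ * ‖b‖ + (a * (starRingEnd ℂ) b).re) = (2 * s.re * ‖b‖) ^ 2 := by
    have hre : (a * (starRingEnd ℂ) b).re = (s.re * s.re - s.im * s.im) * ‖b‖ ^ 2 := by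
      rw [ha, mul_assoc, Complex.mul_conj, Complex.normSq_eq_norm_sq, Complex.re_mul_ofReal]
      simp
    rw [hre, hna, hns]
    ring
  have hquot : (s + Complex.I) / (s - Complex.I) * ((‖s - Complex.I‖ ^ 2 : ℝ) : ℂ) =
      (s + Complex.I) * (starRingEnd ℂ) (s - Complex.I) := by
    rw [← Complex.normSq_eq_norm_sq, ← Complex.mul_conj]
    field_simp
  have hrhs : ((‖b‖ * ‖s - Complex.I‖ ^ 2 : ℝ) : ℂ) * ((s + Complex.I) / (s - Complex.I)) =
      ‖b‖ * ((s + Complex.I) * (starRingEnd ℂ) (s - Complex.I)) := by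
    rw [← hquot]
    push_cast
    ring
  rw [hrhs]
  apply Complex.ext
  · rw [subtended_re, Complex.re_ofReal_mul, hna, hns]
    simp
    ring
  · rw [subtended_im, hroot, Real.sqrt_sq (by positivity), Complex.im_ofReal_mul]
    simp
    ring

/-- Writing `s` for the square root of `a / b` in the right half-plane, this is the harmonic
function of `s` with boundary values `-1` on the segment `[-i, i]` and `1` on the rest of the
imaginary axis. -/
noncomputable def slitPotential (a b : ℂ) : ℝ := 1 - 2 / Real.pi * (subtended a b).arg

lemma arg_subtended_mem (a b : ℂ) : (subtended a b).arg ∈ Set.Icc 0 Real.pi :=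
  ⟨Complex.arg_nonneg_iff.2 (by rw [subtended_im]; positivity), Complex.arg_le_pi _⟩

lemma abs_slitPotential_le (a b : ℂ) : |slitPotential a b| ≤ 1 := by
  obtain ⟨h0, h1⟩ := arg_subtended_mem a b
  have hπ := Real.pi_pos
  have h2 : 2 / Real.pi * (subtended a b).arg ≤ 2 := by
    rw [div_mul_eq_mul_div, div_le_iff₀ hπ]; linarith
  have h3 : 0 ≤ 2 / Real.pi * (subtended a b).arg := by positivity
  rw [slitPotential, abs_le]
  constructor <;> linarith

lemma slitPotential_nonneg {a b : ℂ} (h : ‖b‖ ≤ ‖a‖) : 0 ≤ slitPotential a b := by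
  have h1 : (subtended a b).arg ≤ Real.pi / 2 :=
    Complex.arg_le_pi_div_two_iff.2 (Or.inl (by rw [subtended_re]; linarith))
  have hπ := Real.pi_pos
  have h2 : 2 / Real.pi * (subtended a b).arg ≤ 1 := by
    rw [div_mul_eq_mul_div, div_le_iff₀ hπ]; linarith
  rw [slitPotential]
  linarith

lemma slitPotential_nonpos {a b : ℂ} (h : ‖a‖ < ‖b‖) : slitPotential a b ≤ 0 := by
  have h1 : ¬ (subtended a b).arg ≤ Real.pi / 2 := by
    rw [Complex.arg_le_pi_div_two_iff, subtended_re, subtended_im, not_or]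
    exact ⟨by linarith, not_lt.2 (Real.sqrt_nonneg _)⟩
  have hπ := Real.pi_pos
  have h2 : 1 ≤ 2 / Real.pi * (subtended a b).arg := by
    rw [div_mul_eq_mul_div, le_div_iff₀ hπ]; linarith
  rw [slitPotential]
  linarith

lemma continuousAt_slitPotential {a b : ℂ → ℂ} (ha : Continuous a) (hb : Continuous b) {w : ℂ}
    (h : ‖b w‖ < ‖a w‖) : ContinuousAt (fun w => slitPotential (a w) (b w)) w := by
  have harg : ContinuousAt (fun w => (subtended (a w) (b w)).arg) w :=
    (Complex.continuousAt_arg (Or.inl (by rw [subtended_re]; linarith))).comp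
      (continuous_subtended ha hb).continuousAt
  exact continuousAt_const.sub (continuousAt_const.mul harg)

lemma measurable_slitPotential {a b : ℂ → ℂ} (ha : Continuous a) (hb : Continuous b) :
    Measurable fun w => slitPotential (a w) (b w) :=
  measurable_const.sub (measurable_const.mul
    (Complex.measurable_arg.comp (continuous_subtended ha hb).measurable))

lemma slitPotential_ofReal_of_nonpos {a b : ℝ} (ha : 0 < a) (hb : b ≤ 0) (hab : |b| ≤ a) :
    slitPotential a b = 1 := by
  have : subtended a b = ((a - |b| : ℝ) : ℂ) := by
    rw [subtended]
    have : 2 * (‖(a : ℂ)‖ * ‖(b : ℂ)‖ + ((a : ℂ) * (starRingEnd ℂ) (b : ℂ)).re) = 0 := by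
      simp [abs_of_pos ha, abs_of_nonpos hb]
    rw [this]
    simp [abs_of_pos ha]
  rw [slitPotential, this, Complex.arg_ofReal_of_nonneg (by linarith)]
  simp

lemma slitPotential_ofReal_of_pos {a b : ℝ} (hb : 0 < b) (hab : b < a) :
    slitPotential a b =
      2 / Real.pi * Real.arctan (1 / 2 * (Real.sqrt (a / b) - Real.sqrt (b / a))) := by
  have ha := hb.trans hab
  have him : (subtended a b).im = 2 * (Real.sqrt a * Real.sqrt b) := by
    rw [subtended_im]
    have : 2 * (‖(a : ℂ)‖ * ‖(b : ℂ)‖ + ((a : ℂ) * (starRingEnd ℂ) (b : ℂ)).re) =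
        (2 * (Real.sqrt a * Real.sqrt b)) ^ 2 := by
      rw [mul_pow, mul_pow, Real.sq_sqrt ha.le, Real.sq_sqrt hb.le]
      simp [abs_of_pos ha, abs_of_pos hb]
      ring
    rw [this, Real.sqrt_sq (by positivity)]
  have hre : (subtended a b).re = a - b := by
    rw [subtended_re]; simp [abs_of_pos ha, abs_of_pos hb]
  have hsa := Real.sqrt_pos.2 ha
  have hsb := Real.sqrt_pos.2 hb
  have harg : (subtended a b).arg =
      Real.arctan (2 * (Real.sqrt a * Real.sqrt b) / (a - b)) := by
    rw [← him, ← hre, ← Complex.tan_arg, Real.arctan_tan]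
    · linarith [(arg_subtended_mem a b).1, Real.pi_pos]
    · exact lt_of_abs_lt (Complex.abs_arg_lt_pi_div_two_iff.2 (Or.inl (by rw [hre]; linarith)))
  have hx : 1 / 2 * (Real.sqrt (a / b) - Real.sqrt (b / a)) =
      (2 * (Real.sqrt a * Real.sqrt b) / (a - b))⁻¹ := by
    rw [Real.sqrt_div ha.le, Real.sqrt_div hb.le]
    have e1 := Real.mul_self_sqrt ha.le
    have e2 := Real.mul_self_sqrt hb.le
    field_simp
    rw [sq, sq, e1, e2]
  rw [hx, Real.arctan_inv_of_pos (div_pos (by positivity) (by linarith)), slitPotential, harg]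
  field_simp

/-- Away from the slit, `slitPotential` is the real part of an analytic function. -/
lemma exists_analytic_slitPotential :
    ∃ Φ : ℂ → ℂ, (∀ q ∈ Complex.slitPlane, AnalyticAt ℂ Φ q) ∧
      ∀ a b : ℂ, b ≠ 0 → a / b ∈ Complex.slitPlane → slitPotential a b = (Φ (a / b)).re := by
  let s : ℂ → ℂ := fun q => Complex.exp (Complex.log q / 2)
  have hs : ∀ q ∈ Complex.slitPlane, 0 < (s q).re := fun q hq => by
    obtain ⟨harg, -⟩ := Complex.mem_slitPlane_iff_arg.1 hq
    rw [Complex.exp_re]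
    refine mul_pos (Real.exp_pos _) (Real.cos_pos_of_mem_Ioo ?_)
    have h1 := Complex.neg_pi_lt_arg q
    have h2 := lt_of_le_of_ne (Complex.arg_le_pi q) harg
    have : (Complex.log q / 2).im = q.arg / 2 := by
      simp [Complex.log_im]
    rw [this]
    constructor <;> linarith
  have hsq : ∀ q ∈ Complex.slitPlane, s q * s q = q := fun q hq => by
    rw [← Complex.exp_add, add_halves, Complex.exp_log (Complex.slitPlane_ne_zero hq)]
  have hne : ∀ q ∈ Complex.slitPlane, s q - Complex.I ≠ 0 := fun q hq h => by
    have := congrArg Complex.re h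
    simp at this
    exact (hs q hq).ne' this
  have hmem : ∀ q ∈ Complex.slitPlane,
      (s q + Complex.I) / (s q - Complex.I) ∈ Complex.slitPlane := fun q hq => by
    right
    have hq' : subtended q 1 = ((‖(1 : ℂ)‖ * ‖s q - Complex.I‖ ^ 2 : ℝ) : ℂ) *
      ((s q + Complex.I) / (s q - Complex.I)) :=
        subtended_eq one_ne_zero (hs q hq) (by rw [hsq q hq, div_one])
    intro h0
    have him := congrArg Complex.im hq'
    rw [Complex.im_ofReal_mul, h0, mul_zero, subtended_im, Real.sqrt_eq_zero'] at him
    obtain ⟨harg, hq0⟩ := Complex.mem_slitPlane_iff_arg.1 hq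
    have hre : q.re = -‖q‖ := by
      have h1 := Complex.abs_re_le_norm q
      simp at him
      linarith [(abs_le.1 h1).1]
    have hq2 := Complex.sq_norm q
    rw [Complex.normSq_apply, hre] at hq2
    have him0 : q.im = 0 := by
      have : q.im * q.im = 0 := by linarith
      simpa using this
    rcases hq with hq | hq
    · linarith [norm_nonneg q]
    · exact hq him0
  refine ⟨fun q => 1 + ((2 / Real.pi : ℝ) : ℂ) *
    (Complex.I * Complex.log ((s q + Complex.I) / (s q - Complex.I))), fun q hq => ?_,
    fun a b hb hq => ?_⟩
  · have hlog : AnalyticAt ℂ Complex.log q := analyticAt_clog hq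
    have hsa : AnalyticAt ℂ s q := (hlog.div analyticAt_const two_ne_zero).cexp
    exact analyticAt_const.add (analyticAt_const.mul (analyticAt_const.mul
      (((hsa.add analyticAt_const).div (hsa.sub analyticAt_const) (hne q hq)).clog (hmem q hq))))
  · have hpos : 0 < ‖b‖ * ‖s (a / b) - Complex.I‖ ^ 2 :=
      mul_pos (norm_pos_iff.2 hb) (pow_pos (norm_pos_iff.2 (hne _ hq)) 2)
    rw [slitPotential, subtended_eq hb (hs _ hq) (hsq _ hq), Complex.arg_real_mul _ hpos]
    rw [Complex.add_re, Complex.one_re, Complex.re_ofReal_mul, Complex.I_mul_re, Complex.log_im]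
    ring

lemma exists_exit {f : ℝ → ℂ} (hf : Continuous f) {D : Set ℂ} (hD : IsOpen D)
    (hex : ∃ t, 0 ≤ t ∧ f t ∉ D) :
    ∃ τ, 0 ≤ τ ∧ f τ ∉ D ∧ (∀ t, 0 ≤ t → t < τ → f t ∈ D) ∧
      ∀ B, exitsInto f D B ↔ f τ ∈ B := by
  set S : Set ℝ := {t | 0 ≤ t ∧ f t ∈ Dᶜ} with hS
  have hSc : IsClosed S := isClosed_Ici.inter (hD.isClosed_compl.preimage hf)
  have hbdd : BddBelow S := ⟨0, fun t ht => ht.1⟩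
  have hmem : sInf S ∈ S := hSc.csInf_mem hex hbdd
  have hexit : exitTime f D = ENNReal.ofReal (sInf S) := by
    refine IsLeast.csInf_eq ⟨⟨_, hmem, rfl⟩, ?_⟩
    rintro _ ⟨t, ht, rfl⟩
    exact ENNReal.ofReal_le_ofReal (csInf_le hbdd ht)
  refine ⟨sInf S, hmem.1, hmem.2, fun t ht hlt => ?_, fun B => ⟨?_, fun h => ?_⟩⟩
  · by_contra hn
    exact hlt.not_ge (csInf_le hbdd ⟨ht, hn⟩)
  · rintro ⟨t, ht, heq, hB⟩
    rw [hexit, ENNReal.ofReal_eq_ofReal_iff ht hmem.1] at heq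
    rwa [← heq]
  · exact ⟨_, hmem.1, hexit.symm, h⟩

lemma planarGaussian_norm_lt_le {v : NNReal} (hv : v ≠ 0) (ε : ℝ) :
    planarGaussian v {x | ‖x‖ < ε} ≤
      ENNReal.ofReal (Real.sqrt (2 * Real.pi * v))⁻¹ * ENNReal.ofReal (2 * ε) := by
  have hm : MeasurableSet (Set.Ioo (-ε) ε) := measurableSet_Ioo
  have hsub : (fun p : ℝ × ℝ => Complex.equivRealProd.symm p) ⁻¹' {x | ‖x‖ < ε} ⊆
      Prod.fst ⁻¹' Set.Ioo (-ε) ε := by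
    intro p hp
    have h : |p.1| ≤ ‖Complex.equivRealProd.symm p‖ := by
      simpa using Complex.abs_re_le_norm (Complex.equivRealProd.symm p)
    exact abs_lt.1 (h.trans_lt hp)
  rw [planarGaussian, Measure.map_apply measurable_equivRealProd_symm
    (measurableSet_lt (by fun_prop) measurable_const)]
  calc _ ≤ _ := measure_mono hsub
    _ = ProbabilityTheory.gaussianReal 0 v (Set.Ioo (-ε) ε) :=
      measurePreserving_fst.measure_preimage hm.nullMeasurableSet
    _ = ∫⁻ x in Set.Ioo (-ε) ε, ProbabilityTheory.gaussianPDF 0 v x :=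
      ProbabilityTheory.gaussianReal_apply _ hv _
    _ ≤ ∫⁻ _ in Set.Ioo (-ε) ε, ENNReal.ofReal (Real.sqrt (2 * Real.pi * v))⁻¹ := by
      refine lintegral_mono fun x => ENNReal.ofReal_le_ofReal ?_
      rw [ProbabilityTheory.gaussianPDFReal_def]
      refine mul_le_of_le_one_right (by positivity) (Real.exp_le_one_iff.2 ?_)
      exact div_nonpos_of_nonpos_of_nonneg (neg_nonpos.2 (sq_nonneg _)) (by positivity)
    _ = _ := by
      rw [setLIntegral_const, Real.volume_Ioo]
      ring_nf

lemma ae_exists_notMem_ball {Ω : Type*} [MeasurableSpace Ω] (BM : PlanarBM Ω) (z : ℂ) (ε : ℝ) :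
    ∀ᵐ ω ∂BM.P z, ∃ t, 0 ≤ t ∧ BM.Z t ω ∉ Metric.ball z ε := by
  have hle : ∀ n : ℕ, BM.P z {ω | ¬ ∃ t, 0 ≤ t ∧ BM.Z t ω ∉ Metric.ball z ε} ≤
      ENNReal.ofReal (Real.sqrt (2 * Real.pi * ((n : ℝ) + 1)))⁻¹ * ENNReal.ofReal (2 * ε) := by
    intro n
    have hv : Real.toNNReal ((n : ℝ) + 1 - 0) ≠ 0 := by
      rw [Ne, Real.toNNReal_eq_zero, not_le, sub_zero]; positivity
    have hmeas : MeasurableSet {x : ℂ | ‖x‖ < ε} := measurableSet_lt (by fun_prop) measurable_const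
    have hincr : Measurable fun ω => BM.Z (n + 1) ω - BM.Z 0 ω := (BM.meas _).sub (BM.meas 0)
    calc _ ≤ BM.P z ((fun ω => BM.Z (n + 1) ω - BM.Z 0 ω) ⁻¹' {x : ℂ | ‖x‖ < ε}) := by
          refine measure_mono_ae ?_
          filter_upwards [BM.start z] with ω hω hstay
          have hball : BM.Z (n + 1) ω ∈ Metric.ball z ε := by
            by_contra hn
            exact hstay ⟨n + 1, by positivity, hn⟩
          show ‖BM.Z (n + 1) ω - BM.Z 0 ω‖ < ε
          rwa [hω, ← dist_eq_norm]
      _ = planarGaussian (Real.toNNReal ((n : ℝ) + 1 - 0)) {x | ‖x‖ < ε} := by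
          rw [← Measure.map_apply hincr hmeas, BM.incrLaw z 0 (n + 1) le_rfl (by positivity),
            planarGaussian]
      _ ≤ _ := by
          refine (planarGaussian_norm_lt_le hv ε).trans_eq ?_
          rw [sub_zero, Real.coe_toNNReal _ (by positivity)]
  have hlim : Tendsto (fun n : ℕ => ENNReal.ofReal (Real.sqrt (2 * Real.pi * ((n : ℝ) + 1)))⁻¹ *
      ENNReal.ofReal (2 * ε)) atTop (nhds 0) := by
    have h1 : Tendsto (fun n : ℕ => (Real.sqrt (2 * Real.pi * ((n : ℝ) + 1)))⁻¹) atTop (nhds 0) :=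
      tendsto_inv_atTop_zero.comp (Real.tendsto_sqrt_atTop.comp
        ((tendsto_atTop_add_const_right _ _ tendsto_natCast_atTop_atTop).const_mul_atTop
          (by positivity)))
    have h2 := ENNReal.Tendsto.mul_const (b := ENNReal.ofReal (2 * ε)) (ENNReal.tendsto_ofReal h1)
      (Or.inr ENNReal.ofReal_ne_top)
    simpa using h2
  exact le_antisymm (ge_of_tendsto' hlim hle) zero_le

/-- Fatou's lemma for events: if `M n ≥ -1` has expectations tending to `c`, is asymptotically
nonnegative, and is asymptotically at least `1` on `E`, then `E` has probability at most `c`. -/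
lemma measure_le_of_tendsto_integral {Ω : Type*} [MeasurableSpace Ω] {P : Measure Ω}
    [IsProbabilityMeasure P] {M : ℕ → Ω → ℝ} (hM : ∀ n, Measurable (M n)) {c : ℝ}
    (hc : Tendsto (fun n => ∫ ω, M n ω ∂P) atTop (nhds c)) (hb : ∀ n, ∀ᵐ ω ∂P, |M n ω| ≤ 1)
    {E : Set Ω} (h0 : ∀ᵐ ω ∂P, ∀ᶠ n in atTop, 0 ≤ M n ω)
    (h1 : ∀ᵐ ω ∂P, ω ∈ E → Tendsto (fun n => M n ω) atTop (nhds 1)) :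
    P E ≤ ENNReal.ofReal c := by
  set g : Ω → ENNReal := fun ω => liminf (fun n => ENNReal.ofReal (1 + M n ω)) atTop with hg
  have hmeas : ∀ n, Measurable fun ω => ENNReal.ofReal (1 + M n ω) :=
    fun n => (measurable_const.add (hM n)).ennreal_ofReal
  have hgm : Measurable g := .liminf hmeas
  have hintM : ∀ n, ∫⁻ ω, ENNReal.ofReal (1 + M n ω) ∂P = ENNReal.ofReal (1 + ∫ ω, M n ω ∂P) := by
    intro n
    have hi : Integrable (M n) P := .of_bound (hM n).aestronglyMeasurable 1 (hb n)
    have hi' : Integrable (fun ω => 1 + M n ω) P := (integrable_const 1).add hi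
    rw [← ofReal_integral_eq_lintegral_ofReal hi', integral_add (integrable_const _) hi]
    · simp
    · filter_upwards [hb n] with ω hω
      have := (abs_le.1 hω).1
      simp only [Pi.zero_apply]
      linarith
  have hfatou : ∫⁻ ω, g ω ∂P ≤ ENNReal.ofReal (1 + c) := by
    refine (lintegral_liminf_le hmeas).trans_eq ?_
    rw [funext hintM]
    exact (ENNReal.tendsto_ofReal (tendsto_const_nhds.add hc)).liminf_eq
  set F : Set Ω := {ω | 2 ≤ g ω}
  have hF : MeasurableSet F := measurableSet_le measurable_const hgm
  have hEF : P E ≤ P F := by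
    refine measure_mono_ae ?_
    filter_upwards [h1] with ω hω hE
    show 2 ≤ g ω
    have h2 := (ENNReal.tendsto_ofReal ((hω hE).const_add 1)).liminf_eq
    simp only [hg, h2]
    norm_num
  have hlow : 1 + P F ≤ ∫⁻ ω, g ω ∂P := by
    have : ∫⁻ ω, (1 + F.indicator 1 ω) ∂P = 1 + P F := by
      rw [lintegral_add_left measurable_const, lintegral_indicator_one hF]
      simp
    rw [← this]
    refine lintegral_mono_ae ?_
    filter_upwards [h0] with ω hω
    by_cases hFω : ω ∈ F
    · rw [Set.indicator_of_mem hFω, Pi.one_apply, one_add_one_eq_two]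
      exact hFω
    · rw [Set.indicator_of_notMem hFω, add_zero]
      refine le_liminf_of_le (by isBoundedDefault) (hω.mono fun n hn => ?_)
      rw [← ENNReal.ofReal_one]
      exact ENNReal.ofReal_le_ofReal (by linarith)
  have htot : 1 + P E ≤ ENNReal.ofReal (1 + c) := (add_le_add_right hEF 1).trans (hlow.trans hfatou)
  rcases le_or_gt 0 c with hc0 | hc0
  · rw [ENNReal.ofReal_add zero_le_one hc0, ENNReal.ofReal_one] at htot
    exact (ENNReal.add_le_add_iff_left ENNReal.one_ne_top).1 htot
  · have h2 : ENNReal.ofReal (1 + c) < 1 := by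
      rw [ENNReal.ofReal_lt_one]; linarith
    exact absurd (le_self_add.trans htot) (not_le.2 h2)

/-- If `M n ≤ 1` has expectations tending to `c` and is asymptotically nonpositive off `E`, then
`E` has probability at least `c`. -/
lemma le_measure_of_tendsto_integral {Ω : Type*} [MeasurableSpace Ω] {P : Measure Ω}
    [IsProbabilityMeasure P] {M : ℕ → Ω → ℝ} (hM : ∀ n, Measurable (M n)) {c : ℝ}
    (hc : Tendsto (fun n => ∫ ω, M n ω ∂P) atTop (nhds c)) (hb : ∀ n, ∀ᵐ ω ∂P, |M n ω| ≤ 1)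
    {E : Set Ω} (h0 : ∀ᵐ ω ∂P, ω ∉ E → ∀ᶠ n in atTop, M n ω ≤ 0) :
    ENNReal.ofReal c ≤ P E := by
  set g : Ω → ENNReal := fun ω => liminf (fun n => ENNReal.ofReal (1 - M n ω)) atTop with hg
  have hmeas : ∀ n, Measurable fun ω => ENNReal.ofReal (1 - M n ω) :=
    fun n => (measurable_const.sub (hM n)).ennreal_ofReal
  have hgm : Measurable g := .liminf hmeas
  have hintM : ∀ n, ∫⁻ ω, ENNReal.ofReal (1 - M n ω) ∂P = ENNReal.ofReal (1 - ∫ ω, M n ω ∂P) := by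
    intro n
    have hi : Integrable (M n) P := .of_bound (hM n).aestronglyMeasurable 1 (hb n)
    have hi' : Integrable (fun ω => 1 - M n ω) P := (integrable_const 1).sub hi
    rw [← ofReal_integral_eq_lintegral_ofReal hi', integral_sub (integrable_const _) hi]
    · simp
    · filter_upwards [hb n] with ω hω
      have := (abs_le.1 hω).2
      simp only [Pi.zero_apply]
      linarith
  have hfatou : ∫⁻ ω, g ω ∂P ≤ ENNReal.ofReal (1 - c) := by
    refine (lintegral_liminf_le hmeas).trans_eq ?_
    rw [funext hintM]
    exact (ENNReal.tendsto_ofReal (tendsto_const_nhds.sub hc)).liminf_eq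
  have hcompl : P Eᶜ ≤ ENNReal.ofReal (1 - c) := by
    refine le_trans ?_ ((mul_meas_ge_le_lintegral hgm 1).trans hfatou)
    rw [one_mul]
    refine measure_mono_ae ?_
    filter_upwards [h0] with ω hω hE
    refine le_liminf_of_le (by isBoundedDefault) ((hω hE).mono fun n hn => ?_)
    rw [← ENNReal.ofReal_one]
    exact ENNReal.ofReal_le_ofReal (by linarith)
  have hc1 : c ≤ 1 := le_of_tendsto' hc fun n => by
    have := norm_integral_le_of_norm_le_const (μ := P) (f := M n) (hb n)
    simp only [probReal_univ, mul_one] at this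
    exact (abs_le.1 this).2
  have htot : 1 ≤ P E + ENNReal.ofReal (1 - c) := by
    calc 1 = P (E ∪ Eᶜ) := by simp
      _ ≤ P E + P Eᶜ := measure_union_le _ _
      _ ≤ _ := by gcongr
  calc ENNReal.ofReal c = 1 - ENNReal.ofReal (1 - c) := by
        rw [← ENNReal.ofReal_one, ← ENNReal.ofReal_sub _ (by linarith), sub_sub_cancel]
    _ ≤ P E := tsub_le_iff_right.2 htot

/-- The potential of the slit `{z + t : ρ ≤ t}` in `B(z, R)`: it vanishes on the circle and is `1`
on the slit. -/
noncomputable def diskSlitPotential (z : ℂ) (ρ R : ℝ) (w : ℂ) : ℝ :=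
  slitPotential ((R : ℂ) ^ 2 - ρ * (w - z)) (R * (ρ - (w - z)))

lemma norm_sq_sub_norm_sq_disk (ζ : ℂ) (ρ R : ℝ) :
    ‖(R : ℂ) ^ 2 - ρ * ζ‖ ^ 2 - ‖(R : ℂ) * (ρ - ζ)‖ ^ 2 =
      (R ^ 2 - ρ ^ 2) * (R ^ 2 - ‖ζ‖ ^ 2) := by
  simp only [Complex.sq_norm, Complex.normSq_apply]
  simp [sq]
  ring

lemma norm_lt_norm_disk {ζ : ℂ} {ρ R : ℝ} (hρ : 0 < ρ) (hρR : ρ < R) (h : ‖ζ‖ < R) :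
    ‖(R : ℂ) * (ρ - ζ)‖ < ‖(R : ℂ) ^ 2 - ρ * ζ‖ := by
  refine lt_of_pow_lt_pow_left₀ 2 (norm_nonneg _) (sub_pos.1 ?_)
  rw [norm_sq_sub_norm_sq_disk]
  refine mul_pos (sub_pos.2 (by gcongr)) (sub_pos.2 (by gcongr))

lemma norm_lt_norm_disk_of_lt {ζ : ℂ} {ρ R : ℝ} (hρ : 0 < ρ) (hρR : ρ < R) (h : R < ‖ζ‖) :
    ‖(R : ℂ) ^ 2 - ρ * ζ‖ < ‖(R : ℂ) * (ρ - ζ)‖ := by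
  refine lt_of_pow_lt_pow_left₀ 2 (norm_nonneg _) (sub_neg.1 ?_)
  rw [norm_sq_sub_norm_sq_disk]
  have : R ^ 2 < ‖ζ‖ ^ 2 := by have := hρ.trans hρR; gcongr
  exact mul_neg_of_pos_of_neg (sub_pos.2 (by gcongr)) (sub_neg.2 this)

lemma measurable_diskSlitPotential (z : ℂ) (ρ R : ℝ) : Measurable (diskSlitPotential z ρ R) :=
  measurable_slitPotential (by fun_prop) (by fun_prop)

lemma abs_diskSlitPotential_le (z : ℂ) (ρ R : ℝ) (w : ℂ) : |diskSlitPotential z ρ R w| ≤ 1 :=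
  abs_slitPotential_le _ _

lemma diskSlitPotential_nonneg {z w : ℂ} {ρ R : ℝ} (hρ : 0 < ρ) (hρR : ρ < R) (h : ‖w - z‖ < R) :
    0 ≤ diskSlitPotential z ρ R w :=
  slitPotential_nonneg (norm_lt_norm_disk hρ hρR h).le

lemma diskSlitPotential_nonpos {z w : ℂ} {ρ R : ℝ} (hρ : 0 < ρ) (hρR : ρ < R) (h : R < ‖w - z‖) :
    diskSlitPotential z ρ R w ≤ 0 :=
  slitPotential_nonpos (norm_lt_norm_disk_of_lt hρ hρR h)

lemma continuousAt_diskSlitPotential {z w : ℂ} {ρ R : ℝ} (hρ : 0 < ρ) (hρR : ρ < R)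
    (h : ‖w - z‖ < R) : ContinuousAt (diskSlitPotential z ρ R) w :=
  continuousAt_slitPotential (by fun_prop) (by fun_prop) (norm_lt_norm_disk hρ hρR h)

lemma diskSlitPotential_eq_one {z : ℂ} {ρ R t : ℝ} (hρ : 0 < ρ) (ht : ρ ≤ t) (htR : t < R) :
    diskSlitPotential z ρ R (z + t) = 1 := by
  have hR : 0 < R := by linarith
  have h1 : ρ * t < R ^ 2 := by nlinarith
  have h2 : (R : ℂ) ^ 2 - ρ * (z + t - z) = ((R ^ 2 - ρ * t : ℝ) : ℂ) := by push_cast; ring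
  have h3 : (R : ℂ) * (ρ - (z + t - z)) = ((R * (ρ - t) : ℝ) : ℂ) := by push_cast; ring
  have h4 : R * (ρ - t) ≤ 0 := mul_nonpos_of_nonneg_of_nonpos hR.le (by linarith)
  rw [diskSlitPotential, h2, h3]
  refine slitPotential_ofReal_of_nonpos (by linarith) h4 ?_
  rw [abs_of_nonpos h4]
  nlinarith [mul_pos (sub_pos.2 htR) (by linarith : 0 < R + ρ)]

lemma diskSlitPotential_self {z : ℂ} {ρ R : ℝ} (hρ : 0 < ρ) (hρR : ρ < R) :
    diskSlitPotential z ρ R z =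
      2 / Real.pi * Real.arctan (1 / 2 * (Real.sqrt (R / ρ) - Real.sqrt (ρ / R))) := by
  have hR : 0 < R := by linarith
  have h2 : (R : ℂ) ^ 2 - ρ * (z - z) = ((R ^ 2 : ℝ) : ℂ) := by push_cast; ring
  have h3 : (R : ℂ) * (ρ - (z - z)) = ((R * ρ : ℝ) : ℂ) := by push_cast; ring
  rw [diskSlitPotential, h2, h3, slitPotential_ofReal_of_pos (by positivity) (by nlinarith),
    sq, mul_div_mul_left _ _ hR.ne', mul_div_mul_left _ _ hR.ne']

lemma disk_quotient_mem_slitPlane {ζ : ℂ} {ρ R : ℝ} (hρ : 0 < ρ) (hρR : ρ < R)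
    (h : ∀ t : ℝ, ρ ≤ t → ζ ≠ t) :
    (R : ℂ) * (ρ - ζ) ≠ 0 ∧
      ((R : ℂ) ^ 2 - ρ * ζ) / (R * (ρ - ζ)) ∈ Complex.slitPlane := by
  have hR : 0 < R := by linarith
  have hb : (R : ℂ) * (ρ - ζ) ≠ 0 :=
    mul_ne_zero (by exact_mod_cast hR.ne') (sub_ne_zero.2 (h ρ le_rfl).symm)
  refine ⟨hb, ?_⟩
  by_contra hq
  rw [Complex.mem_slitPlane_iff_not_le_zero, not_not] at hq
  obtain ⟨s, hs, hsq⟩ : ∃ s : ℝ, 0 ≤ s ∧ ((R : ℂ) ^ 2 - ρ * ζ) / (R * (ρ - ζ)) = -(s : ℂ) := by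
    rw [Complex.le_def] at hq
    refine ⟨-(((R : ℂ) ^ 2 - ρ * ζ) / (R * (ρ - ζ))).re, by simpa using hq.1, ?_⟩
    apply Complex.ext
    · simp
    · simpa using hq.2
  rw [div_eq_iff hb] at hsq
  have hpos : 0 < ρ + s * R := by positivity
  refine h ((R ^ 2 + s * R * ρ) / (ρ + s * R)) ?_ ?_
  · rw [le_div_iff₀ hpos]; nlinarith
  · have : ((ρ + s * R : ℝ) : ℂ) ≠ 0 := by exact_mod_cast hpos.ne'
    rw [Complex.ofReal_div, eq_div_iff this]
    push_cast
    linear_combination -hsq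

lemma isOpen_ball_diff_radialSlit (z : ℂ) (ρ ε : ℝ) :
    IsOpen (Metric.ball z ε \ radialSlit z ρ ε) := by
  refine Metric.isOpen_ball.sdiff ?_
  have : radialSlit z ρ ε = (fun t : ℝ => z + (t : ℂ)) '' Set.Icc ρ ε := by
    ext w
    constructor
    · rintro ⟨t, h1, h2, rfl⟩
      exact ⟨t, ⟨h1, h2⟩, rfl⟩
    · rintro ⟨t, ⟨h1, h2⟩, rfl⟩
      exact ⟨t, h1, h2, rfl⟩
  rw [this]
  exact (isCompact_Icc.image (by fun_prop)).isClosed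

lemma sub_ne_ofReal_of_mem {z w : ℂ} {ρ ε : ℝ} (hρ : 0 < ρ)
    (hw : w ∈ Metric.ball z ε \ radialSlit z ρ ε) {t : ℝ} (ht : ρ ≤ t) : w - z ≠ t := by
  intro h
  refine hw.2 ⟨t, ht, ?_, by rw [← h]; ring⟩
  have h1 := hw.1
  rw [mem_ball_iff_norm, h, Complex.norm_real, Real.norm_of_nonneg (hρ.le.trans ht)] at h1
  exact h1.le

lemma circleAverage_diskSlitPotential {z : ℂ} {ρ R ε : ℝ} (hρ : 0 < ρ) (hρR : ρ < R) {w : ℂ}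
    {s : ℝ} (hs : 0 ≤ s) (hD : Metric.closedBall w s ⊆ Metric.ball z ε \ radialSlit z ρ ε) :
    Real.circleAverage (diskSlitPotential z ρ R) w s = diskSlitPotential z ρ R w := by
  obtain ⟨Φ, hΦ, hre⟩ := exists_analytic_slitPotential
  let q : ℂ → ℂ := fun x => ((R : ℂ) ^ 2 - ρ * (x - z)) / (R * (ρ - (x - z)))
  have hq : ∀ x ∈ Metric.closedBall w s, (R : ℂ) * (ρ - (x - z)) ≠ 0 ∧ q x ∈ Complex.slitPlane :=
    fun x hx => disk_quotient_mem_slitPlane hρ hρR fun t ht => sub_ne_ofReal_of_mem hρ (hD hx) ht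
  have heq : ∀ x ∈ Metric.closedBall w s, diskSlitPotential z ρ R x = (Φ (q x)).re :=
    fun x hx => hre _ _ (hq x hx).1 (hq x hx).2
  have hharm : InnerProductSpace.HarmonicOnNhd (fun x => (Φ (q x)).re)
      (Metric.closedBall w |s|) := by
    rw [abs_of_nonneg hs]
    intro x hx
    have hqa : AnalyticAt ℂ q x := by
      refine AnalyticAt.div ?_ ?_ (hq x hx).1 <;> fun_prop
    have : AnalyticAt ℂ (fun x => Φ (q x)) x := (hΦ _ (hq x hx).2).comp hqa
    exact this.harmonicAt_re
  rw [heq w (Metric.mem_closedBall_self hs), ← hharm.circleAverage_eq]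
  refine Real.circleAverage_congr_sphere fun x hx => heq x ?_
  rw [abs_of_nonneg hs] at hx
  exact Metric.sphere_subset_closedBall hx

/-- Samplings of the potential along Brownian motion, at positions converging to the exit position
`x`, whose expectations converge to the potential at the starting point. -/
lemma exists_diskSlit_sampling {Ω : Type*} [MeasurableSpace Ω] (BM : PlanarBM Ω) (z : ℂ)
    {ρ R ε : ℝ} (hρ : 0 < ρ) (hρR : ρ < R) (hρε : ρ < ε) :
    ∃ M : ℕ → Ω → ℝ, (∀ n, Measurable (M n)) ∧
      Tendsto (fun n => ∫ ω, M n ω ∂BM.P z) atTop (nhds (diskSlitPotential z ρ R z)) ∧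
      ∀ᵐ ω ∂BM.P z, ∃ (x : ℂ) (p : ℕ → ℂ), (∀ n, M n ω = diskSlitPotential z ρ R (p n)) ∧
        Tendsto p atTop (nhds x) ∧ x ∉ Metric.ball z ε \ radialSlit z ρ ε ∧ ‖x - z‖ ≤ ε ∧
        (exitsInto (fun t => BM.Z t ω) (Metric.ball z ε \ radialSlit z ρ ε) (radialSlit z ρ ε) ↔
          x ∈ radialSlit z ρ ε) := by
  have hε : 0 < ε := hρ.trans hρε
  set D := Metric.ball z ε \ radialSlit z ρ ε with hDdef
  have hD : IsOpen D := isOpen_ball_diff_radialSlit z ρ ε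
  obtain ⟨M, hM, hlim, hs⟩ := exists_sampling BM z (measurable_diskSlitPotential z ρ R)
    (abs_diskSlitPotential_le z ρ R) hD
    fun w s hs hsub => circleAverage_diskSlitPotential hρ hρR hs hsub
  refine ⟨M, hM, hlim, ?_⟩
  filter_upwards [hs, BM.start z, BM.contPaths z, ae_exists_notMem_ball BM z ε]
    with ω ⟨s, hsM, hst⟩ hstart hcont ⟨t, ht, htb⟩
  obtain ⟨τ, hτ0, hτD, hτ, hexit⟩ := exists_exit hcont hD ⟨t, ht, fun h => htb h.1⟩
  refine ⟨BM.Z τ ω, fun n => BM.Z (s n) ω, fun n => (hsM n).2,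
    (hcont.tendsto τ).comp (hst τ hτ0 hτD hτ), hτD, ?_, hexit _⟩
  rcases hτ0.eq_or_lt with rfl | hpos
  · simpa [hstart] using hε.le
  · refine le_of_tendsto ((((hcont.tendsto τ).sub_const z).norm).mono_left nhdsWithin_le_nhds)
      (Filter.mem_of_superset (Ioo_mem_nhdsLT hpos) fun t ht => ?_)
    exact (mem_ball_iff_norm.1 (hτ t ht.1.le ht.2).1).le

lemma hm_le_diskSlitPotential {Ω : Type*} [MeasurableSpace Ω] (BM : PlanarBM Ω) (z : ℂ)
    {ρ R ε : ℝ} (hρ : 0 < ρ) (hρε : ρ < ε) (hR : ε < R) :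
    Hm BM (Metric.ball z ε \ radialSlit z ρ ε) (radialSlit z ρ ε) z ≤
      ENNReal.ofReal (diskSlitPotential z ρ R z) := by
  have := BM.isProb z
  have hρR := hρε.trans hR
  obtain ⟨M, hM, hlim, hs⟩ := exists_diskSlit_sampling BM z hρ hρR hρε
  refine measure_le_of_tendsto_integral hM hlim (fun n => ?_) ?_ ?_
  · filter_upwards [hs] with ω ⟨x, p, hp, _⟩
    rw [hp]
    exact abs_diskSlitPotential_le _ _ _ _
  · filter_upwards [hs] with ω ⟨x, p, hp, hpx, _, hx, _⟩
    filter_upwards [((hpx.sub_const z).norm).eventually_lt_const (hx.trans_lt hR)] with n hn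
    rw [hp]
    exact diskSlitPotential_nonneg hρ hρR hn
  · filter_upwards [hs] with ω ⟨x, p, hp, hpx, _, hx, hiff⟩ hE
    obtain ⟨t, h1, h2, rfl⟩ := hiff.1 hE
    have h := (continuousAt_diskSlitPotential hρ hρR (hx.trans_lt hR)).tendsto.comp hpx
    rw [diskSlitPotential_eq_one hρ h1 (h2.trans_lt hR)] at h
    exact h.congr fun n => (hp n).symm

lemma diskSlitPotential_le_hm {Ω : Type*} [MeasurableSpace Ω] (BM : PlanarBM Ω) (z : ℂ)
    {ρ R ε : ℝ} (hρ : 0 < ρ) (hρR : ρ < R) (hR : R < ε) :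
    ENNReal.ofReal (diskSlitPotential z ρ R z) ≤
      Hm BM (Metric.ball z ε \ radialSlit z ρ ε) (radialSlit z ρ ε) z := by
  have := BM.isProb z
  obtain ⟨M, hM, hlim, hs⟩ := exists_diskSlit_sampling BM z hρ hρR (hρR.trans hR)
  refine le_measure_of_tendsto_integral hM hlim (fun n => ?_) ?_
  · filter_upwards [hs] with ω ⟨x, p, hp, _⟩
    rw [hp]
    exact abs_diskSlitPotential_le _ _ _ _
  · filter_upwards [hs] with ω ⟨x, p, hp, hpx, hxD, _, hiff⟩ hE
    have hx : ε ≤ ‖x - z‖ := by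
      by_contra! hlt
      exact hxD ⟨mem_ball_iff_norm.2 hlt, fun hslit => hE (hiff.2 hslit)⟩
    filter_upwards [((hpx.sub_const z).norm).eventually_const_lt (hR.trans_le hx)] with n hn
    rw [hp]
    exact diskSlitPotential_nonpos hρ hρR hn

lemma hm_radialSlit_eq {Ω : Type*} [MeasurableSpace Ω] (BM : PlanarBM Ω) (z : ℂ) {ρ ε : ℝ}
    (hρ : 0 < ρ) (hρε : ρ < ε) :
    Hm BM (Metric.ball z ε \ radialSlit z ρ ε) (radialSlit z ρ ε) z =
      ENNReal.ofReal (2 / Real.pi *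
        Real.arctan (1 / 2 * (Real.sqrt (ε / ρ) - Real.sqrt (ρ / ε)))) := by
  have hε : ε ≠ 0 := (hρ.trans hρε).ne'
  have hlim : Tendsto (fun R => ENNReal.ofReal (2 / Real.pi *
      Real.arctan (1 / 2 * (Real.sqrt (R / ρ) - Real.sqrt (ρ / R))))) (nhds ε)
      (nhds (ENNReal.ofReal (2 / Real.pi *
        Real.arctan (1 / 2 * (Real.sqrt (ε / ρ) - Real.sqrt (ρ / ε)))))) := by
    refine ENNReal.tendsto_ofReal (ContinuousAt.tendsto ?_)
    fun_prop (disch := assumption)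
  refine le_antisymm ?_ ?_
  · refine ge_of_tendsto (hlim.mono_left (nhdsWithin_le_nhds (s := Set.Ioi ε)))
      (Filter.mem_of_superset self_mem_nhdsWithin fun R hR => ?_)
    show _ ≤ ENNReal.ofReal _
    rw [← diskSlitPotential_self (z := z) hρ (hρε.trans hR)]
    exact hm_le_diskSlitPotential BM z hρ hρε hR
  · refine le_of_tendsto (hlim.mono_left (nhdsWithin_le_nhds (s := Set.Iio ε)))
      (Filter.mem_of_superset (Ioo_mem_nhdsLT hρε) fun R hR => ?_)
    show ENNReal.ofReal _ ≤ _
    rw [← diskSlitPotential_self (z := z) hρ hR.1]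
    exact diskSlitPotential_le_hm BM z hρ hR.1 hR.2

lemma tendsto_slit_formula {ε : ℝ} (hε : 0 < ε) :
    Tendsto (fun ρ : ℝ => 2 / Real.pi *
      Real.arctan (1 / 2 * (Real.sqrt (ε / ρ) - Real.sqrt (ρ / ε))))
      (nhdsWithin 0 (Set.Ioi 0)) (nhds 1) := by
  have h1 : Tendsto (fun ρ : ℝ => Real.sqrt (ε / ρ)) (nhdsWithin 0 (Set.Ioi 0)) atTop :=
    Real.tendsto_sqrt_atTop.comp (tendsto_inv_nhdsGT_zero.const_mul_atTop hε)
  have h2 : Tendsto (fun ρ : ℝ => -Real.sqrt (ρ / ε)) (nhdsWithin 0 (Set.Ioi 0)) (nhds 0) := by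
    have : Continuous fun ρ : ℝ => -Real.sqrt (ρ / ε) := by fun_prop
    simpa using (this.tendsto 0).mono_left nhdsWithin_le_nhds
  have h3 := (h1.atTop_add h2).const_mul_atTop (by norm_num : (0 : ℝ) < 1 / 2)
  have h4 := ((Real.tendsto_arctan_atTop.mono_right nhdsWithin_le_nhds).comp h3).const_mul
    (2 / Real.pi)
  rw [div_mul_div_comm, mul_comm, div_self (mul_ne_zero Real.pi_ne_zero two_ne_zero)] at h4
  simpa only [sub_eq_add_neg, Function.comp_def] using h4

/-- Harmonic measure of a radial slit seen from the center of the disk: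
explicit formula, and it tends to 1 as the slit grows (ρ → 0). -/
theorem hm_radial_slit {Ω : Type*} [MeasurableSpace Ω]
    (BM : PlanarBM Ω) (z : ℂ) (ε : ℝ) (hε : 0 < ε) :
    (∀ ρ : ℝ, 0 < ρ → ρ < ε →
      Hm BM (Metric.ball z ε \ radialSlit z ρ ε) (radialSlit z ρ ε) z =
        ENNReal.ofReal
          (2 / Real.pi *
            Real.arctan (1 / 2 * (Real.sqrt (ε / ρ) - Real.sqrt (ρ / ε))))) ∧
    Tendsto (fun ρ : ℝ => Hm BM (Metric.ball z ε \ radialSlit z ρ ε) (radialSlit z ρ ε) z)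
      (nhdsWithin 0 (Set.Ioi 0)) (nhds 1) := by
  refine ⟨fun ρ hρ hρε => hm_radialSlit_eq BM z hρ hρε, ?_⟩
  rw [← ENNReal.ofReal_one]
  refine (ENNReal.tendsto_ofReal (tendsto_slit_formula hε)).congr' ?_
  filter_upwards [Ioo_mem_nhdsGT hε] with ρ hρ
  exact (hm_radialSlit_eq BM z hρ.1 hρ.2).symm
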